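/- arXiv:math/0008232 — 2 statements merged into one kernel-verified Lean document; each statement's English description precedes it below -/
import Mathlib

section
/- Let H be a finite-dimensional Hopf algebra over ℂ. Then the Jacobson radical Rad(H) is a Hopf ideal if and only if the tensor product of any two simple H-modules is semisimple. -/
open TensorProduct

/-- The `H`-module structure on the tensor product of two `H`-modules, given by the
comultiplication of the bialgebra `H`. -/
noncomputable def tensorModule (H : Type) [Ring H] [Bialgebra ℂ H]
    (M N : Type) [AddCommGroup M] [Module ℂ M] [Module H M] [IsScalarTower ℂ H M]
    [AddCommGroup N] [Module ℂ N] [Module H N] [IsScalarTower ℂ H N] : Module H (M ⊗[ℂ] N) :=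
  Module.compHom (M ⊗[ℂ] N)
    (((Module.endTensorEndAlgHom (R := ℂ) (S := ℂ) (A := ℂ) (M := M) (N := N)).comp
      ((Algebra.TensorProduct.map (Algebra.lsmul ℂ ℂ M) (Algebra.lsmul ℂ ℂ N)).comp
        (Bialgebra.comulAlgHom ℂ H))).toRingHom)

/-- An ideal `I` of a Hopf algebra `H` is a Hopf ideal if `Δ(I) ⊆ I ⊗ H + H ⊗ I`,
`ε(I) = 0` and `S(I) ⊆ I`. -/
def IsHopfIdeal (H : Type) [Ring H] [HopfAlgebra ℂ H] (I : Ideal H) : Prop :=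
  (∀ x ∈ I, Coalgebra.comul (R := ℂ) x ∈
      LinearMap.range (TensorProduct.map (I.restrictScalars ℂ).subtype (LinearMap.id (M := H))) ⊔
      LinearMap.range (TensorProduct.map (LinearMap.id (M := H)) (I.restrictScalars ℂ).subtype)) ∧
  (∀ x ∈ I, Coalgebra.counit (R := ℂ) x = 0) ∧
  (∀ x ∈ I, HopfAlgebra.antipode (R := ℂ) x ∈ I)

/-- The action of `H ⊗ H` on `M ⊗ N`. -/
noncomputable def actHH (H : Type) [Ring H] [Bialgebra ℂ H]
    (M N : Type) [AddCommGroup M] [Module ℂ M] [Module H M] [IsScalarTower ℂ H M]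
    [AddCommGroup N] [Module ℂ N] [Module H N] [IsScalarTower ℂ H N] :
    (H ⊗[ℂ] H) →ₐ[ℂ] Module.End ℂ (M ⊗[ℂ] N) :=
  (Module.endTensorEndAlgHom (R := ℂ) (S := ℂ) (A := ℂ) (M := M) (N := N)).comp
      (Algebra.TensorProduct.map (Algebra.lsmul ℂ ℂ M) (Algebra.lsmul ℂ ℂ N))

theorem actHH_tmul (H : Type) [Ring H] [Bialgebra ℂ H]
    (M N : Type) [AddCommGroup M] [Module ℂ M] [Module H M] [IsScalarTower ℂ H M]
    [AddCommGroup N] [Module ℂ N] [Module H N] [IsScalarTower ℂ H N] (a b : H) (m : M) (n : N) :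
    actHH H M N (a ⊗ₜ b) (m ⊗ₜ n) = (a • m) ⊗ₜ (b • n) := by
  simp [actHH, Module.endTensorEndAlgHom_apply]

theorem tensor_kill (H : Type) [Ring H] [Bialgebra ℂ H]
    (M N : Type) [AddCommGroup M] [Module ℂ M] [Module H M] [IsScalarTower ℂ H M]
    [AddCommGroup N] [Module ℂ N] [Module H N] [IsScalarTower ℂ H N]
    (hss : letI := tensorModule H M N
      IsSemisimpleModule H (M ⊗[ℂ] N)) (x : H) (hx : x ∈ Ring.jacobson H) (t : M ⊗[ℂ] N) :
    actHH H M N (Coalgebra.comul (R := ℂ) x) t = 0 := by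
  let _ := tensorModule H M N
  have := Module.mem_annihilator.mp
          (IsSemisimpleModule.jacobson_le_annihilator H (M ⊗[ℂ] N) hx) t
  exact this

/-- naturality of the action -/
theorem actHH_map (H : Type) [Ring H] [Bialgebra ℂ H]
    (M N M' N' : Type) [AddCommGroup M] [Module ℂ M] [Module H M] [IsScalarTower ℂ H M]
    [AddCommGroup N] [Module ℂ N] [Module H N] [IsScalarTower ℂ H N]
    [AddCommGroup M'] [Module ℂ M'] [Module H M'] [IsScalarTower ℂ H M']
    [AddCommGroup N'] [Module ℂ N'] [Module H N'] [IsScalarTower ℂ H N']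
    (f : M →ₗ[H] M') (g : N →ₗ[H] N') (w : H ⊗[ℂ] H) (m : M) (n : N) :
    actHH H M' N' w (f m ⊗ₜ g n) =
      TensorProduct.map (f.restrictScalars ℂ) (g.restrictScalars ℂ)
        (actHH H M N w (m ⊗ₜ n)) := by
  induction w with
  | zero => simp
  | tmul a b => simp [actHH_tmul]
  | add x y hx hy => simp [hx, hy]

/-- An ideal killing both factors, compatible with comultiplication, kills the tensor product. -/
theorem actHH_eq_zero (H : Type) [Ring H] [Bialgebra ℂ H] (I : Ideal H)
    (M N : Type) [AddCommGroup M] [Module ℂ M] [Module H M] [IsScalarTower ℂ H M]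
    [AddCommGroup N] [Module ℂ N] [Module H N] [IsScalarTower ℂ H N]
    (hM : ∀ x ∈ I, ∀ m : M, x • m = 0) (hN : ∀ x ∈ I, ∀ n : N, x • n = 0)
    (w : H ⊗[ℂ] H)
    (hw : w ∈ LinearMap.range (TensorProduct.map (I.restrictScalars ℂ).subtype (LinearMap.id (M := H))) ⊔
      LinearMap.range (TensorProduct.map (LinearMap.id (M := H)) (I.restrictScalars ℂ).subtype)) :
    actHH H M N w = 0 := by
  have : LinearMap.range (TensorProduct.map (I.restrictScalars ℂ).subtype (LinearMap.id (M := H))) ⊔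
      LinearMap.range (TensorProduct.map (LinearMap.id (M := H)) (I.restrictScalars ℂ).subtype)
      ≤ LinearMap.ker (actHH H M N).toLinearMap := by
    rw [sup_le_iff, LinearMap.range_le_ker_iff, LinearMap.range_le_ker_iff]
    constructor
    · ext a b m n
      simp [actHH_tmul, hM a.1 a.2]
    · ext a b m n
      simp [actHH_tmul, hN b.1 b.2]
  exact this hw

theorem map_eq_act (H : Type) [Ring H] [Bialgebra ℂ H]
    (M : Type) [AddCommGroup M] [Module ℂ M] [Module H M] [IsScalarTower ℂ H M]
    (p : H →ₗ[H] M) (w : H ⊗[ℂ] H) :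
    TensorProduct.map (p.restrictScalars ℂ) (p.restrictScalars ℂ) w =
      actHH H M M w (p 1 ⊗ₜ p 1) := by
  induction w with
  | zero => simp
  | tmul a b => simp [actHH_tmul, ← map_smul]
  | add x y hx hy => simp [hx, hy]

theorem mem_of_map (H : Type) [Ring H] [Bialgebra ℂ H] (I : Ideal H)
    (M : Type) [AddCommGroup M] [Module ℂ M] [Module H M] [IsScalarTower ℂ H M]
    (p : H →ₗ[H] M) (hp : Function.Surjective p) (hI : LinearMap.ker p = I) (w : H ⊗[ℂ] H)
    (hw : TensorProduct.map (p.restrictScalars ℂ) (p.restrictScalars ℂ) w = 0) :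
    w ∈ LinearMap.range (TensorProduct.map (I.restrictScalars ℂ).subtype (LinearMap.id (M := H))) ⊔
      LinearMap.range (TensorProduct.map (LinearMap.id (M := H))
        (I.restrictScalars ℂ).subtype) := by
  have hp' : Function.Surjective (p.restrictScalars ℂ) := hp
  have hex : Function.Exact (I.restrictScalars ℂ).subtype (p.restrictScalars ℂ) := by
    intro y
    subst hI
    simp
  have hker := TensorProduct.map_ker hex hp' hex hp'
  have hm : w ∈ LinearMap.ker
      (TensorProduct.map (p.restrictScalars ℂ) (p.restrictScalars ℂ)) := hw
  rw [hker, sup_comm] at hm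
  exact hm

theorem isSemi_of_torsion (H M : Type) [Ring H] [IsArtinianRing H] [AddCommGroup M] [Module H M]
    (hk : Module.IsTorsionBySet H M (Ring.jacobson H : Set H)) : IsSemisimpleModule H M := by
  let _ := hk.module
  exact hk.isSemisimpleModule_iff.mp inferInstance

theorem span_simple (H M : Type) [Ring H] [AddCommGroup M] [Module H M] [IsSemisimpleModule H M]
    (P : M → Prop) (h0 : P 0) (hadd : ∀ x y, P x → P y → P (x + y))
    (hs : ∀ S : Submodule H M, IsSimpleModule H S → ∀ x : S, P x) (x : M) : P x := by
  have hx : x ∈ sSup { m : Submodule H M | IsSimpleModule H m } := by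
    rw [IsSemisimpleModule.sSup_simples_eq_top]; trivial
  rw [sSup_eq_iSup'] at hx
  induction hx using Submodule.iSup_induction' with
  | mem i x hx => exact hs i.1 i.2 ⟨x, hx⟩
  | zero => exact h0
  | add x y _ _ hx hy => exact hadd x y hx hy

/-- In a finite-dimensional Hopf algebra a bi-ideal is stable under the antipode. -/
theorem antipode_mem (H : Type) [Ring H] [HopfAlgebra ℂ H] [FiniteDimensional ℂ H]
    (I : Ideal H) [I.IsTwoSided]
    (h1 : ∀ x ∈ I, Coalgebra.comul (R := ℂ) x ∈
      LinearMap.range (TensorProduct.map (I.restrictScalars ℂ).subtype (LinearMap.id (M := H))) ⊔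
      LinearMap.range (TensorProduct.map (LinearMap.id (M := H)) (I.restrictScalars ℂ).subtype))
    (h2 : ∀ x ∈ I, Coalgebra.counit (R := ℂ) x = 0) :
    ∀ x ∈ I, HopfAlgebra.antipode (R := ℂ) x ∈ I := by
  let A : Submodule ℂ (WithConv (H →ₗ[ℂ] H)) :=
    { carrier := {f | ∀ x ∈ I, f.ofConv x ∈ I}
      add_mem' := fun {f g} hf hg x hx => by
        simpa using I.add_mem (hf x hx) (hg x hx)
      zero_mem' := fun x hx => by simp
      smul_mem' := fun c f hf x hx => by
        simpa using (I.restrictScalars ℂ).smul_mem c (hf x hx) }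
  have hmul : ∀ f ∈ A, ∀ g ∈ A, f * g ∈ A := by
    intro f hf g hg x hx
    have key : LinearMap.range (TensorProduct.map (I.restrictScalars ℂ).subtype (LinearMap.id (M := H))) ⊔
      LinearMap.range (TensorProduct.map (LinearMap.id (M := H)) (I.restrictScalars ℂ).subtype)
      ≤ (I.restrictScalars ℂ).comap (LinearMap.mul' ℂ H ∘ₗ TensorProduct.map f.ofConv g.ofConv) := by
      rw [sup_le_iff]
      constructor
      · rintro _ ⟨t, rfl⟩
        induction t with
        | zero => simp
        | tmul a b => simpa using I.mul_mem_right _ (hf a.1 a.2)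
        | add a b ha hb => rw [map_add]; exact Submodule.add_mem _ ha hb
      · rintro _ ⟨t, rfl⟩
        induction t with
        | zero => simp
        | tmul a b => simpa using I.mul_mem_left _ (hg b.1 b.2)
        | add a b ha hb => rw [map_add]; exact Submodule.add_mem _ ha hb
    exact key (h1 x hx)
  have hone : (1 : WithConv (H →ₗ[ℂ] H)) ∈ A := by
    intro x hx
    have : (1 : WithConv (H →ₗ[ℂ] H)).ofConv x = 0 := by
      change algebraMap ℂ H (Coalgebra.counit (R := ℂ) x) = 0
      rw [h2 x hx, map_zero]
    rw [this]; exact I.zero_mem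
  let e : WithConv (H →ₗ[ℂ] H) := WithConv.toConv LinearMap.id
  let s : WithConv (H →ₗ[ℂ] H) := WithConv.toConv (HopfAlgebra.antipode ℂ (A := H))
  have hse : s * e = 1 := LinearMap.antipode_mul_id
  have hes : e * s = 1 := LinearMap.id_mul_antipode
  have he : e ∈ A := fun x hx => hx
  have : FiniteDimensional ℂ (WithConv (H →ₗ[ℂ] H)) :=
    Module.Finite.equiv (WithConv.linearEquiv ℂ (H →ₗ[ℂ] H)).symm
  let L : A →ₗ[ℂ] A := (LinearMap.mulLeft ℂ e).restrict (fun f hf => hmul e he f hf)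
  have hL : Function.Injective L := by
    intro f g hfg
    have h : e * f.1 = e * g.1 := congrArg Subtype.val hfg
    ext1
    rw [← one_mul f.1, ← one_mul g.1, ← hse, mul_assoc, mul_assoc, h]
  obtain ⟨f, hf⟩ := (LinearMap.injective_iff_surjective.mp hL) ⟨1, hone⟩
  have hf' : e * f.1 = 1 := congrArg Subtype.val hf
  have hfs : f.1 = s := by
    rw [← one_mul f.1, ← hse, mul_assoc, hf', mul_one]
  have hs : s ∈ A := hfs ▸ f.2
  exact hs

/-- For a finite-dimensional Hopf algebra `H` over `ℂ`, the Jacobson radical of `H` is a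
Hopf ideal if and only if the tensor product of any two simple `H`-modules is semisimple
(the Chevalley property). -/
theorem stmt_6 (H : Type) [Ring H] [HopfAlgebra ℂ H] [FiniteDimensional ℂ H] :
    IsHopfIdeal H ((⊥ : Ideal H).jacobson) ↔
    (∀ (M N : Type) (_ : AddCommGroup M) (_ : Module ℂ M) (_ : Module H M)
        (_ : IsScalarTower ℂ H M) (_ : AddCommGroup N) (_ : Module ℂ N)
        (_ : Module H N) (_ : IsScalarTower ℂ H N),
        IsSimpleModule H M → IsSimpleModule H N →
        letI := tensorModule H M N
        IsSemisimpleModule H (M ⊗[ℂ] N)) := by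
  have : IsArtinianRing H := IsArtinianRing.of_finite ℂ H
  rw [Ideal.jacobson_bot]
  constructor
  · rintro ⟨h1, -, -⟩ M N _ _ _ _ _ _ _ _ hM hN
    letI := tensorModule H M N
    have hk : Module.IsTorsionBySet H (M ⊗[ℂ] N) (Ring.jacobson H : Set H) := by
      rintro t ⟨x, hx⟩
      change actHH H M N (Coalgebra.comul (R := ℂ) x) t = 0
      rw [actHH_eq_zero H (Ring.jacobson H) M N _ _ _ (h1 x hx)]
      · rfl
      · intro y hy m
        exact Module.mem_annihilator.mp (IsSemisimpleModule.jacobson_le_annihilator H M hy) m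
      · intro y hy m
        exact Module.mem_annihilator.mp (IsSemisimpleModule.jacobson_le_annihilator H N hy) m
    exact isSemi_of_torsion H _ hk
  · intro h
    have h2 : ∀ x ∈ Ring.jacobson H, Coalgebra.counit (R := ℂ) x = 0 := by
      intro x hx
      obtain ⟨n, hn⟩ := IsSemiprimaryRing.isNilpotent (R := H)
      have hxn : x ^ n = 0 := by
        have := Ideal.pow_mem_pow hx n
        rw [hn] at this
        simpa using this
      have := congrArg (Bialgebra.counitAlgHom ℂ H) hxn
      rw [map_pow, map_zero] at this
      exact eq_zero_of_pow_eq_zero this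
    have h1 : ∀ x ∈ Ring.jacobson H, Coalgebra.comul (R := ℂ) x ∈
      LinearMap.range (TensorProduct.map ((Ring.jacobson H).restrictScalars ℂ).subtype (LinearMap.id (M := H))) ⊔
      LinearMap.range (TensorProduct.map (LinearMap.id (M := H)) ((Ring.jacobson H).restrictScalars ℂ).subtype) := by
      intro x hx
      have hss : IsSemisimpleModule H (H ⧸ Ring.jacobson H) := by
        have hk : Module.IsTorsionBySet H (H ⧸ Ring.jacobson H) (Ring.jacobson H : Set H) :=
          (Module.isTorsionBySet_quotient_iff _ _).mpr
            fun a r hr => (Ring.jacobson H).mul_mem_right a hr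
        exact isSemi_of_torsion H _ hk
      have key : ∀ m n : H ⧸ Ring.jacobson H,
          actHH H (H ⧸ Ring.jacobson H) (H ⧸ Ring.jacobson H)
            (Coalgebra.comul (R := ℂ) x) (m ⊗ₜ n) = 0 := by
        intro m n
        refine span_simple H _ (fun m => actHH H (H ⧸ Ring.jacobson H) (H ⧸ Ring.jacobson H)
            (Coalgebra.comul (R := ℂ) x) (m ⊗ₜ n) = 0) (by simp) ?_ ?_ m
        · intro a b ha hb
          rw [TensorProduct.add_tmul, map_add, ha, hb, add_zero]
        intro S hS m
        refine span_simple H _ (fun n => actHH H (H ⧸ Ring.jacobson H) (H ⧸ Ring.jacobson H)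
            (Coalgebra.comul (R := ℂ) x) ((m : H ⧸ Ring.jacobson H) ⊗ₜ n) = 0) (by simp) ?_ ?_ n
        · intro a b ha hb
          rw [TensorProduct.tmul_add, map_add, ha, hb, add_zero]
        intro T hT n
        have := actHH_map H S T _ _ S.subtype T.subtype (Coalgebra.comul (R := ℂ) x) m n
        refine this.trans ?_
        rw [tensor_kill H S T (h S T _ _ _ _ _ _ _ _ hS hT) x hx, map_zero]
      refine mem_of_map H (Ring.jacobson H) (H ⧸ Ring.jacobson H)
        (Submodule.mkQ (Ring.jacobson H)) (Submodule.mkQ_surjective _)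
        (Submodule.ker_mkQ _) _ ?_
      rw [map_eq_act, key]
    exact ⟨h1, h2, antipode_mem H _ h1 h2⟩
end

section
/- Let H be a finite-dimensional Hopf algebra over a field of characteristic 0 whose coradical is contained in the subalgebra on which S² = Id and such that the subalgebra generated by the coradical is a Hopf subalgebra with S² = Id on it; then that subalgebra is cosemisimple and equals the coradical. More precisely: if B is a finite-dimensional Hopf algebra over ℂ with S² = Id, then B is cosemisimple. -/
open TensorProduct

/-- A submodule `C` of a coalgebra `A` is a subcoalgebra if `Δ(C) ⊆ C ⊗ C`. -/
def IsSubcoalgebra (k A : Type) [Field k] [AddCommGroup A] [Module k A] [Coalgebra k A]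
    (C : Submodule k A) : Prop :=
  ∀ x ∈ C, Coalgebra.comul (R := k) x ∈
    LinearMap.range (TensorProduct.map C.subtype C.subtype)

/-- A subcoalgebra is simple if it is nonzero and has no proper nonzero subcoalgebras. -/
def IsSimpleSubcoalgebra (k A : Type) [Field k] [AddCommGroup A] [Module k A]
    [Coalgebra k A] (C : Submodule k A) : Prop :=
  IsSubcoalgebra k A C ∧ C ≠ ⊥ ∧
    ∀ D : Submodule k A, IsSubcoalgebra k A D → D ≤ C → D = ⊥ ∨ D = C


open Coalgebra HopfAlgebra

namespace LR

section coalg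
variable {B : Type} [AddCommGroup B] [Module ℂ B] [Coalgebra ℂ B]
variable {n : ℕ} (b : Module.Basis (Fin n) ℂ B)

/-- slice a tensor by a functional on the left factor -/
noncomputable def sl (f : B →ₗ[ℂ] ℂ) (M : Type) [AddCommGroup M] [Module ℂ M] :
    B ⊗[ℂ] M →ₗ[ℂ] M :=
  (TensorProduct.lid ℂ M).toLinearMap ∘ₗ f.rTensor M

@[simp] lemma sl_tmul (f : B →ₗ[ℂ] ℂ) (M : Type) [AddCommGroup M] [Module ℂ M] (x : B) (m : M) :
    sl f M (x ⊗ₜ m) = f x • m := by simp [sl]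

lemma expand (M : Type) [AddCommGroup M] [Module ℂ M] (z : B ⊗[ℂ] M) :
    z = ∑ i, b i ⊗ₜ[ℂ] sl (b.coord i) M z := by
  induction z with
  | zero => simp
  | add x y hx hy =>
    conv_lhs => rw [hx, hy]
    simp [TensorProduct.tmul_add, Finset.sum_add_distrib]
  | tmul x m =>
    conv_lhs => rw [← b.sum_repr x]
    rw [TensorProduct.sum_tmul]
    simp [TensorProduct.smul_tmul']

noncomputable def tt (i j : Fin n) : B := sl (b.coord i) B (comul (R := ℂ) (b j))

lemma comul_basis (j : Fin n) : comul (R := ℂ) (b j) = ∑ i, b i ⊗ₜ[ℂ] tt b i j :=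
  expand b B _

lemma comul_tt (i j : Fin n) : comul (R := ℂ) (tt b i j) = ∑ k, tt b i k ⊗ₜ[ℂ] tt b k j := by
  have h := coassoc_apply (R := ℂ) (b j)
  rw [comul_basis] at h
  simp only [map_sum, LinearMap.rTensor_tmul, LinearMap.lTensor_tmul, comul_basis,
    TensorProduct.sum_tmul, TensorProduct.assoc_tmul] at h
  have h2 := congrArg (sl (b.coord i) (B ⊗[ℂ] B)) h
  simp only [map_sum, sl_tmul, Module.Basis.coord_apply, Module.Basis.repr_self,
    Finsupp.single_apply, ite_smul, one_smul, zero_smul] at h2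
  simpa using h2.symm

lemma counit_tt (i j : Fin n) : counit (R := ℂ) (tt b i j) = if i = j then 1 else 0 := by
  have h := lTensor_counit_comul (R := ℂ) (b j)
  rw [comul_basis] at h
  have h2 := congrArg (sl (b.coord i) ℂ) h
  simp [Finsupp.single_apply] at h2
  simpa [eq_comm] using h2

lemma basis_eq (j : Fin n) : b j = ∑ i, counit (R := ℂ) (b i) • tt b i j := by
  have h := rTensor_counit_comul (R := ℂ) (b j)
  rw [comul_basis] at h
  have h2 := congrArg (TensorProduct.lid ℂ B) h
  simpa using h2.symm

lemma ext_tt {M : Type} [AddCommGroup M] [Module ℂ M] {f g : B →ₗ[ℂ] M}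
    (h : ∀ i j, f (tt b i j) = g (tt b i j)) : f = g := by
  refine b.ext fun j => ?_
  rw [basis_eq b j]
  simp [h]

noncomputable def cv (f g : B →ₗ[ℂ] ℂ) : B →ₗ[ℂ] ℂ :=
  LinearMap.mul' ℂ ℂ ∘ₗ TensorProduct.map f g ∘ₗ comul

noncomputable def mm (f : B →ₗ[ℂ] ℂ) : Matrix (Fin n) (Fin n) ℂ := Matrix.of fun i j => f (tt b i j)

lemma mm_cv (f g : B →ₗ[ℂ] ℂ) : mm b (cv f g) = mm b f * mm b g := by
  ext i j
  simp [mm, cv, comul_tt, Matrix.mul_apply]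

lemma mm_inj {f g : B →ₗ[ℂ] ℂ} (h : mm b f = mm b g) : f = g :=
  ext_tt b fun i j => congrFun (congrFun h i) j

lemma cv_assoc [FiniteDimensional ℂ B] (f g k : B →ₗ[ℂ] ℂ) : cv (cv f g) k = cv f (cv g k) :=
  mm_inj (Module.finBasis ℂ B) (by simp [mm_cv, mul_assoc])

/-- `x ↦ x₁ e(x₂)` -/
noncomputable def qq (e : B →ₗ[ℂ] ℂ) : B →ₗ[ℂ] B :=
  (TensorProduct.rid ℂ B).toLinearMap ∘ₗ e.lTensor B ∘ₗ comul

lemma qq_tt (e : B →ₗ[ℂ] ℂ) (i j : Fin n) :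
    qq e (tt b i j) = ∑ k, e (tt b k j) • tt b i k := by
  simp [qq, comul_tt]

lemma apply_qq (a e : B →ₗ[ℂ] ℂ) (x : B) : a (qq e x) = cv a e x := by
  simp only [qq, cv, LinearMap.comp_apply]
  generalize (comul x : B ⊗[ℂ] B) = z
  induction z with
  | zero => simp
  | add x y hx hy => simp only [map_add, hx, hy]
  | tmul x m => simp [mul_comm]

lemma eq_of_dual {x y : B} (h : ∀ a : B →ₗ[ℂ] ℂ, a x = a y) : x = y := by
  rw [← sub_eq_zero, ← Module.forall_dual_apply_eq_zero_iff ℂ]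
  intro a; simp [h]

lemma vanish {C : Submodule ℂ B} (hC : IsSubcoalgebra ℂ B C) {M : Type} [AddCommGroup M]
    [Module ℂ M] (F : B ⊗[ℂ] B →ₗ[ℂ] M) (hF : ∀ x ∈ C, ∀ y ∈ C, F (x ⊗ₜ y) = 0) :
    ∀ x ∈ C, F (comul x) = 0 := by
  intro x hx
  obtain ⟨z, hz⟩ := hC x hx
  rw [← hz]
  induction z generalizing x with
  | zero => simp
  | add u v hu hv => 
    have key : ∀ z, F (TensorProduct.map C.subtype C.subtype z) = 0 := by
      intro z
      induction z with
      | zero => simp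
      | add u v hu hv => simp [hu, hv]
      | tmul u v => simpa using hF u u.2 v v.2
    exact key _
  | tmul u v => simpa using hF u u.2 v v.2

/-- Complement subcoalgebra from a coseparability form. -/
lemma complement [FiniteDimensional ℂ B] (σ : B →ₗ[ℂ] B →ₗ[ℂ] ℂ)
    (s1 : ∀ (a : B →ₗ[ℂ] ℂ) (x y : B), cv a (σ.flip y) x = cv (σ x) a y)
    (s2 : ∀ x, TensorProduct.lift σ (comul x) = counit (R := ℂ) x)
    (C : Submodule ℂ B) (hC : IsSubcoalgebra ℂ B C) (hT : C ≠ ⊤) :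
    ∃ D : Submodule ℂ B, IsSubcoalgebra ℂ B D ∧ D ≠ ⊥ ∧ D ⊓ C = ⊥ := by
  let b := Module.finBasis ℂ B
  obtain ⟨Q, hQ⟩ := LinearMap.exists_leftInverse_of_injective C.subtype (by simp)
  let P : B →ₗ[ℂ] B := LinearMap.id - C.subtype ∘ₗ Q
  have hP0 : ∀ x ∈ C, P x = 0 := by
    intro x hx
    have := LinearMap.congr_fun hQ ⟨x, hx⟩
    simp at this
    simp [P, this]
  have hP1 : ∀ x, x - P x ∈ C := by intro x; simp [P]
  let e : B →ₗ[ℂ] ℂ := TensorProduct.lift (σ.compl₂ P) ∘ₗ comul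
  let e' : B →ₗ[ℂ] ℂ := TensorProduct.lift (σ ∘ₗ P) ∘ₗ comul
  have he : ∀ x ∈ C, e x = 0 := by
    refine vanish hC (TensorProduct.lift (σ.compl₂ P)) ?_
    intro x hx y hy; simp [hP0 y hy]
  have he' : ∀ x ∈ C, e' x = 0 := by
    refine vanish hC (TensorProduct.lift (σ ∘ₗ P)) ?_
    intro x hx y hy; simp [hP0 x hx]
  have hl : ∀ a c : B →ₗ[ℂ] ℂ, (∀ x ∈ C, a x = 0) → ∀ x ∈ C, cv a c x = 0 := by
    intro a c ha
    refine vanish hC (LinearMap.mul' ℂ ℂ ∘ₗ TensorProduct.map a c) ?_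
    intro x hx y hy; simp [ha x hx]
  have hr : ∀ a c : B →ₗ[ℂ] ℂ, (∀ x ∈ C, a x = 0) → ∀ x ∈ C, cv c a x = 0 := by
    intro a c ha
    refine vanish hC (LinearMap.mul' ℂ ℂ ∘ₗ TensorProduct.map c a) ?_
    intro x hx y hy; simp [ha y hy]
  have s1' : ∀ (a : B →ₗ[ℂ] ℂ) (i j) (y : B),
      ∑ k, a (tt b i k) * σ (tt b k j) y = cv (σ (tt b i j)) a y := by
    intro a i j y
    rw [← s1]; simp [cv, comul_tt]
  have s1'' : ∀ (a : B →ₗ[ℂ] ℂ) (i j) (x : B),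
      cv a (σ.flip (tt b i j)) x = ∑ k, σ x (tt b i k) * a (tt b k j) := by
    intro a i j y
    rw [s1]; simp [cv, comul_tt]
  have s2' : ∀ i j, ∑ k, σ (tt b i k) (tt b k j) = if i = j then 1 else 0 := by
    intro i j
    have := s2 (tt b i j)
    rw [counit_tt] at this
    simpa [comul_tt] using this
  have hae : ∀ a : B →ₗ[ℂ] ℂ, (∀ x ∈ C, a x = 0) → cv a e = a := by
    intro a ha
    refine ext_tt b fun i j => ?_
    have h1 : ∀ l m, cv (σ (tt b i l)) a (P (tt b l m)) = cv (σ (tt b i l)) a (tt b l m) := by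
      intro l m
      have := hr a (σ (tt b i l)) ha _ (hP1 (tt b l m))
      rw [map_sub, sub_eq_zero] at this
      exact this.symm
    calc cv a e (tt b i j) = ∑ k, ∑ l, a (tt b i k) * σ (tt b k l) (P (tt b l j)) := by
          simp [cv, e, comul_tt, Finset.mul_sum]
      _ = ∑ l, ∑ k, a (tt b i k) * σ (tt b k l) (P (tt b l j)) := Finset.sum_comm
      _ = ∑ l, cv (σ (tt b i l)) a (tt b l j) := by
          simp only [s1', h1]
      _ = ∑ l, ∑ k, σ (tt b i l) (tt b l k) * a (tt b k j) := by simp [cv, comul_tt]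
      _ = ∑ k, ∑ l, σ (tt b i l) (tt b l k) * a (tt b k j) := Finset.sum_comm
      _ = a (tt b i j) := by simp [← Finset.sum_mul, s2']
  have hea : ∀ a : B →ₗ[ℂ] ℂ, (∀ x ∈ C, a x = 0) → cv e' a = a := by
    intro a ha
    refine ext_tt b fun i j => ?_
    have h1 : ∀ l m, cv a (σ.flip (tt b l j)) (P (tt b m l)) = cv a (σ.flip (tt b l j)) (tt b m l) := by
      intro l m
      have := hl a (σ.flip (tt b l j)) ha _ (hP1 (tt b m l))
      rw [map_sub, sub_eq_zero] at this
      exact this.symm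
    calc cv e' a (tt b i j) = ∑ k, ∑ l, σ (P (tt b i l)) (tt b l k) * a (tt b k j) := by
          simp [cv, e', comul_tt, Finset.sum_mul]
      _ = ∑ l, ∑ k, σ (P (tt b i l)) (tt b l k) * a (tt b k j) := Finset.sum_comm
      _ = ∑ l, cv a (σ.flip (tt b l j)) (tt b i l) := by
          simp only [← s1'', h1]
      _ = ∑ l, ∑ k, a (tt b i k) * σ (tt b k l) (tt b l j) := by simp [cv, comul_tt]
      _ = ∑ k, ∑ l, a (tt b i k) * σ (tt b k l) (tt b l j) := Finset.sum_comm
      _ = a (tt b i j) := by simp [← Finset.mul_sum, s2']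
  have hee : e = e' := by rw [← hea e he, hae e' he']
  rw [← hee] at hea
  have hcent : ∀ a, cv a e = cv e a := by
    intro a
    rw [← hea (cv a e) (hr e a he), ← cv_assoc, hae (cv e a) (hl e a he)]
  have hq : ∀ i j, qq e (tt b i j) = ∑ k, e (tt b i k) • tt b k j := by
    intro i j
    refine eq_of_dual fun a => ?_
    rw [apply_qq, hcent]
    simp [cv, comul_tt]
  have hE : ∀ i j, ∑ k, e (tt b i k) * e (tt b k j) = e (tt b i j) := by
    intro i j
    have := LinearMap.congr_fun (hae e he) (tt b i j)
    simpa [cv, comul_tt] using this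
  have hcomul : ∀ x, comul (R := ℂ) (qq e x) = TensorProduct.map (qq e) (qq e) (comul x) := by
    intro x
    refine LinearMap.congr_fun (f := comul ∘ₗ qq e)
      (g := TensorProduct.map (qq e) (qq e) ∘ₗ comul) (ext_tt b fun i j => ?_) x
    have L : comul (R := ℂ) (qq e (tt b i j)) = ∑ l, tt b i l ⊗ₜ[ℂ] qq e (tt b l j) := by
      rw [qq_tt]
      simp only [map_sum, map_smul, comul_tt, qq_tt, Finset.smul_sum, TensorProduct.tmul_sum,
        TensorProduct.tmul_smul]
      exact Finset.sum_comm
    have R : TensorProduct.map (qq e) (qq e) (comul (tt b i j))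
        = ∑ l, ∑ k, ∑ m, (e (tt b k l) * e (tt b l m)) • (tt b i k ⊗ₜ[ℂ] tt b m j) := by
      rw [comul_tt]
      simp only [map_sum, TensorProduct.map_tmul]
      refine Finset.sum_congr rfl fun l _ => ?_
      rw [hq l j, qq_tt]
      simp only [TensorProduct.sum_tmul, TensorProduct.tmul_sum, TensorProduct.smul_tmul_smul]
      exact Finset.sum_comm
    simp only [LinearMap.comp_apply]
    rw [L, R, Finset.sum_comm]
    refine Finset.sum_congr rfl fun k _ => ?_
    rw [Finset.sum_comm, hq]
    simp only [← Finset.sum_smul, hE, TensorProduct.tmul_sum, TensorProduct.tmul_smul]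
  have hidem : ∀ x, qq e (qq e x) = qq e x := by
    intro x
    refine eq_of_dual fun a => ?_
    rw [apply_qq, apply_qq, apply_qq, cv_assoc, hae e he]
  refine ⟨LinearMap.range (qq e), ?_, ?_, ?_⟩
  · rintro _ ⟨x, rfl⟩
    rw [hcomul]
    refine ⟨TensorProduct.map (qq e).rangeRestrict (qq e).rangeRestrict (comul x), ?_⟩
    rw [← LinearMap.comp_apply, ← TensorProduct.map_comp]
    rfl
  · intro hD
    apply hT
    rw [eq_top_iff]
    intro x _
    by_contra hx
    obtain ⟨a, ha, haC⟩ := Submodule.exists_le_ker_of_notMem hx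
    have := LinearMap.congr_fun (hae a fun y hy => haC hy) x
    rw [← apply_qq, (LinearMap.range_eq_bot.1 hD)] at this
    apply ha
    simpa using this.symm
  · rw [eq_bot_iff]
    rintro _ ⟨⟨y, rfl⟩, hy⟩
    have : qq e (qq e y) = 0 := by
      refine eq_of_dual fun a => ?_
      rw [apply_qq, hr e a he _ hy, map_zero]
    rw [hidem] at this
    simpa using this

lemma final [FiniteDimensional ℂ B]
    (H : ∀ C : Submodule ℂ B, IsSubcoalgebra ℂ B C → C ≠ ⊤ →
      ∃ D : Submodule ℂ B, IsSubcoalgebra ℂ B D ∧ D ≠ ⊥ ∧ D ⊓ C = ⊥) :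
    sSup {C : Submodule ℂ B | IsSimpleSubcoalgebra ℂ B C} = ⊤ := by
  set C := sSup {C : Submodule ℂ B | IsSimpleSubcoalgebra ℂ B C} with hCdef
  have hC : IsSubcoalgebra ℂ B C := by
    have : C ≤ (LinearMap.range (TensorProduct.map C.subtype C.subtype)).comap
        (comul (R := ℂ) (A := B)) := by
      refine sSup_le ?_
      intro D hD x hx
      have hle : D ≤ C := le_sSup hD
      obtain ⟨z, hz⟩ := hD.1 x hx
      refine ⟨TensorProduct.map (Submodule.inclusion hle) (Submodule.inclusion hle) z, ?_⟩
      rw [← LinearMap.comp_apply, ← TensorProduct.map_comp, ← hz]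
      rfl
    exact fun x hx => this hx
  by_contra hT
  obtain ⟨D, hD, hD0, hDC⟩ := H C hC hT
  obtain ⟨E, hE, hmin⟩ := WellFounded.has_min (wellFounded_lt (α := Submodule ℂ B))
    {E | IsSubcoalgebra ℂ B E ∧ E ≠ ⊥ ∧ E ≤ D} ⟨D, hD, hD0, le_rfl⟩
  have hs : IsSimpleSubcoalgebra ℂ B E := by
    refine ⟨hE.1, hE.2.1, fun F hF hFE => ?_⟩
    by_contra! hcon
    exact hmin F ⟨hF, hcon.1, hFE.trans hE.2.2⟩ (lt_of_le_of_ne hFE hcon.2)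
  have h1 : E ≤ C := le_sSup hs
  exact hE.2.1 (eq_bot_iff.2 (hDC ▸ le_inf hE.2.2 h1))

end coalg

section hopf
variable {B : Type} [Ring B] [HopfAlgebra ℂ B]
variable {n : ℕ} (b : Module.Basis (Fin n) ℂ B)

local notation "S" => HopfAlgebra.antipode (R := ℂ) (A := B)

lemma tS (i j : Fin n) : ∑ k, tt b i k * S (tt b k j) = if i = j then 1 else 0 := by
  have := mul_antipode_lTensor_comul_apply (R := ℂ) (tt b i j)
  rw [counit_tt] at this
  simpa [comul_tt, apply_ite] using this

lemma St (i j : Fin n) : ∑ k, S (tt b i k) * tt b k j = if i = j then 1 else 0 := by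
  have := mul_antipode_rTensor_comul_apply (R := ℂ) (tt b i j)
  rw [counit_tt] at this
  simpa [comul_tt, apply_ite] using this

lemma tS' (h : S ∘ₗ S = LinearMap.id) (i j : Fin n) :
    ∑ k, tt b k j * S (tt b i k) = if i = j then 1 else 0 := by
  have := congrArg S (tS b i j)
  have h' : ∀ x, S (S x) = x := fun x => LinearMap.congr_fun h x
  simpa [antipode_mul_antidistrib, h', apply_ite (S)] using this

lemma comul_S (i j : Fin n) :
    comul (R := ℂ) (S (tt b i j)) = ∑ k, S (tt b k j) ⊗ₜ[ℂ] S (tt b i k) := by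
  let X : Matrix (Fin n) (Fin n) (B ⊗[ℂ] B) := Matrix.of fun i j => comul (R := ℂ) (S (tt b i j))
  let Y : Matrix (Fin n) (Fin n) (B ⊗[ℂ] B) := Matrix.of fun i j => comul (R := ℂ) (tt b i j)
  let Z : Matrix (Fin n) (Fin n) (B ⊗[ℂ] B) :=
    Matrix.of fun i j => ∑ k, S (tt b k j) ⊗ₜ[ℂ] S (tt b i k)
  have hXY : X * Y = 1 := by
    ext i j
    simp only [Matrix.mul_apply, X, Y, Matrix.of_apply, ← Bialgebra.comul_mul, ← map_sum, St]
    rw [apply_ite (comul (R := ℂ) (A := B))]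
    simp [Matrix.one_apply]
  have hYZ : Y * Z = 1 := by
    ext i j
    simp only [Matrix.mul_apply, Y, Z, Matrix.of_apply, comul_tt, Finset.sum_mul_sum,
      Algebra.TensorProduct.tmul_mul_tmul]
    have : ∀ p q, ∑ k, (tt b i p * S (tt b q j)) ⊗ₜ[ℂ] (tt b p k * S (tt b k q))
      = if p = q then (tt b i p * S (tt b q j)) ⊗ₜ[ℂ] 1 else 0 := by
      intro p q
      rw [← TensorProduct.tmul_sum, tS]
      split_ifs <;> simp
    calc _ = ∑ p, ∑ q, ∑ k, (tt b i p * S (tt b q j)) ⊗ₜ[ℂ] (tt b p k * S (tt b k q)) := by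
          rw [Finset.sum_comm]
          exact Finset.sum_congr rfl fun _ _ => Finset.sum_comm
      _ = ∑ p, (tt b i p * S (tt b p j)) ⊗ₜ[ℂ] 1 := by simp [this]
      _ = _ := by
          rw [← TensorProduct.sum_tmul, tS, Matrix.one_apply]
          split_ifs <;> simp [Algebra.TensorProduct.one_def]
  have : X = Z := left_inv_eq_right_inv hXY hYZ
  exact congrFun (congrFun this i) j

noncomputable def lam (B : Type) [Ring B] [HopfAlgebra ℂ B] : B →ₗ[ℂ] ℂ :=
  LinearMap.trace ℂ B ∘ₗ LinearMap.mul ℂ B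

lemma lam_eq (x : B) : lam B x = ∑ j, b.repr (x * b j) j := by
  simp [lam, LinearMap.trace_eq_matrix_trace ℂ b, Matrix.trace, LinearMap.toMatrix_apply]

lemma lam_integral {n : ℕ} (b : Module.Basis (Fin n) ℂ B) (h : S ∘ₗ S = LinearMap.id) (x : B) :
    sl (lam B) B (comul x) = lam B x • (1 : B) := by
  refine LinearMap.congr_fun (f := sl (lam B) B ∘ₗ comul)
    (g := (lam B).smulRight (1 : B)) (ext_tt b fun p q => ?_) x
  have key : ∀ l j, ∑ i, b.repr (tt b p q * b j) i • tt b l i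
      = ∑ i, (∑ r, b.repr (tt b p r * b i) l • tt b r q) * tt b i j := by
    intro l j
    have h1 : sl (b.coord l) B (comul (R := ℂ) (tt b p q * b j))
        = ∑ i, b.repr (tt b p q * b j) i • tt b l i := by
      conv_lhs => rw [← b.sum_repr (tt b p q * b j)]
      simp only [map_sum, map_smul]
      rfl
    rw [← h1, Bialgebra.comul_mul, comul_tt, comul_basis]
    simp only [Finset.sum_mul, Finset.mul_sum, Algebra.TensorProduct.tmul_mul_tmul, map_sum,
      sl_tmul, Module.Basis.coord_apply, smul_mul_assoc]
    try exact Finset.sum_comm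
  have hN : ∀ l, ∑ r, b.repr (tt b p r * b l) l • tt b r q
      = ∑ j, ∑ i, b.repr (tt b p q * b j) i • (tt b l i * S (tt b j l)) := by
    intro l
    have : ∀ j, ∑ i, b.repr (tt b p q * b j) i • (tt b l i * S (tt b j l))
       = ∑ i, (∑ r, b.repr (tt b p r * b i) l • tt b r q) * (tt b i j * S (tt b j l)) := by
      intro j
      have := congrArg (· * S (tt b j l)) (key l j)
      simpa only [Finset.sum_mul, smul_mul_assoc, mul_assoc] using this
    simp only [this]
    rw [Finset.sum_comm]
    simp only [← Finset.mul_sum, tS]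
    simp
  simp only [LinearMap.comp_apply, comul_tt, map_sum, sl_tmul, LinearMap.smulRight_apply]
  simp only [lam_eq b, Finset.sum_smul]
  rw [Finset.sum_comm]
  simp only [hN]
  rw [Finset.sum_comm]
  refine Finset.sum_congr rfl fun j _ => ?_
  rw [Finset.sum_comm]
  simp only [← Finset.smul_sum, tS' b h]
  simp

end hopf

end LR

theorem stmt_10 (B : Type) [Ring B] [HopfAlgebra ℂ B] [FiniteDimensional ℂ B]
    (h : HopfAlgebra.antipode (R := ℂ) (A := B) ∘ₗ HopfAlgebra.antipode (R := ℂ) (A := B) =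
      LinearMap.id) :
    sSup {C : Submodule ℂ B | IsSimpleSubcoalgebra ℂ B C} = ⊤ := by
  rcases subsingleton_or_nontrivial B with hB | hB
  · exact Subsingleton.elim _ _
  let b := Module.finBasis ℂ B
  have hn : LR.lam B 1 ≠ 0 := by
    have : LR.lam B 1 = Module.finrank ℂ B := by
      rw [LR.lam_eq b]; simp
    rw [this]
    exact_mod_cast Module.finrank_pos.ne'
  let σ : B →ₗ[ℂ] B →ₗ[ℂ] ℂ :=
    (LR.lam B 1)⁻¹ • ((LinearMap.mul ℂ B).compr₂ (LR.lam B)) ∘ₗ HopfAlgebra.antipode (R := ℂ) (A := B)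
  have hσ : ∀ x y, σ x y = (LR.lam B 1)⁻¹ * LR.lam B (HopfAlgebra.antipode (R := ℂ) (A := B) x * y) := by
    intro x y; simp [σ]
  have key : ∀ i j k l, ∑ p, LR.lam B (HopfAlgebra.antipode (R := ℂ) (A := B) (LR.tt b p j) * LR.tt b k l) • LR.tt b i p
      = ∑ m, LR.lam B (HopfAlgebra.antipode (R := ℂ) (A := B) (LR.tt b i j) * LR.tt b k m) • LR.tt b m l := by
    intro i j k l
    have h1 : ∀ p, LR.lam B (HopfAlgebra.antipode (R := ℂ) (A := B) (LR.tt b p j) * LR.tt b k l) • LR.tt b i p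
        = ∑ q, ∑ m, LR.lam B (HopfAlgebra.antipode (R := ℂ) (A := B) (LR.tt b q j) * LR.tt b k m) •
          (LR.tt b i p * HopfAlgebra.antipode (R := ℂ) (A := B) (LR.tt b p q) * LR.tt b m l) := by
      intro p
      have := congrArg (LR.tt b i p * ·) (LR.lam_integral b h
        (HopfAlgebra.antipode (R := ℂ) (A := B) (LR.tt b p j) * LR.tt b k l))
      simp only [Bialgebra.comul_mul, LR.comul_S, LR.comul_tt, Finset.sum_mul, Finset.mul_sum,
        Algebra.TensorProduct.tmul_mul_tmul, map_sum, LR.sl_tmul, mul_smul_comm, mul_one] at this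
      rw [← this]
      try rw [Finset.sum_comm]
      simp only [mul_assoc]
    simp only [h1]
    rw [Finset.sum_comm]
    have h2 : ∀ q, ∑ p, ∑ m, LR.lam B (HopfAlgebra.antipode (R := ℂ) (A := B) (LR.tt b q j) * LR.tt b k m) •
          (LR.tt b i p * HopfAlgebra.antipode (R := ℂ) (A := B) (LR.tt b p q) * LR.tt b m l)
        = if i = q then ∑ m, LR.lam B (HopfAlgebra.antipode (R := ℂ) (A := B) (LR.tt b q j) * LR.tt b k m) • LR.tt b m l else 0 := by
      intro q
      rw [Finset.sum_comm]
      simp only [← Finset.smul_sum, ← Finset.sum_mul, LR.tS]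
      split_ifs <;> simp
    simp [h2]
  refine LR.final (LR.complement σ ?_ ?_)
  · intro a x y
    have e1 : ∀ k l, LR.cv a (σ.flip (LR.tt b k l)) = σ.flip (LR.qq a (LR.tt b k l)) := by
      intro k l
      refine LR.ext_tt b fun i j => ?_
      have := congrArg (fun z => (LR.lam B 1)⁻¹ * a z) (key i j k l)
      simp only [map_sum, map_smul, smul_eq_mul, Finset.mul_sum] at this
      simp only [LR.cv, LR.qq_tt, LinearMap.comp_apply, LR.comul_tt, map_sum, map_smul, TensorProduct.map_tmul,
        LinearMap.mul'_apply, LinearMap.flip_apply, LinearMap.sum_apply, LinearMap.smul_apply,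
        smul_eq_mul, hσ]
      refine Eq.trans (Finset.sum_congr rfl fun _ _ => ?_) (this.trans (Finset.sum_congr rfl fun _ _ => ?_)) <;> ring
    rw [← LR.apply_qq (σ x) a y]
    have e2 : ∀ (y : B), LR.cv a (σ.flip y) x = σ x (LR.qq a y) := by
      let F : B →ₗ[ℂ] ℂ := 
        { toFun := fun y => LR.cv a (σ.flip y) x
          map_add' := by intro u v; simp [LR.cv, TensorProduct.map_add_right]
          map_smul' := by intro u v; simp [LR.cv, TensorProduct.map_smul_right] }
      intro y
      refine LinearMap.congr_fun (f := F) (g := σ x ∘ₗ LR.qq a) (LR.ext_tt b fun k l => ?_) y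
      have := LinearMap.congr_fun (e1 k l) x
      exact this
    exact e2 y
  · intro x
    refine LinearMap.congr_fun (f := TensorProduct.lift σ ∘ₗ comul) (g := counit) (LR.ext_tt b fun i j => ?_) x
    simp only [LinearMap.comp_apply, LR.comul_tt, map_sum, TensorProduct.lift.tmul, hσ, LR.counit_tt]
    rw [← Finset.mul_sum, ← map_sum, LR.St]
    split_ifs <;> simp [hn]
end
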